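/- arXiv:1712.08513 — 6 statements merged into one kernel-verified Lean document; each statement's English description precedes it below -/
import Mathlib

section
/- Let H be a complex normed vector space, let r ≥ 0 be a real number, and let D, c, e : H → H be continuous linear maps satisfying c ∘ c = −id, e ∘ e = −r·id, c ∘ D = −D ∘ c, c ∘ e = −e ∘ c, and e ∘ D = −D ∘ e. For a twice differentiable function u : (0,∞) → H define (Nu)(s) = c(u′(s)) + s⁻¹·D(u(s)) + i·e(u(s)). Then Nu is differentiable on (0,∞) and for all s > 0, (N(Nu))(s) = −u″(s) + s⁻²·((D∘D)(u(s)) − (c∘D)(u(s))) + r·u(s). -/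
open Set

/-- For continuous linear maps `D, c, e` on a complex normed space with `c² = -id`,
`e² = -r·id`, and all pairs among `c, e, D` anticommuting, the operator
`(N u)(s) = c u'(s) + s⁻¹ D u(s) + i e u(s)` applied twice to a twice differentiable
`u : (0,∞) → H` gives `(N(Nu))(s) = -u''(s) + s⁻²(D² u(s) - cD u(s)) + r u(s)`. -/
theorem stmt_2 {H : Type*} [NormedAddCommGroup H] [NormedSpace ℂ H]
    (r : ℝ) (hr : 0 ≤ r)
    (D c e : H →L[ℂ] H)
    (hcc : c.comp c = -(ContinuousLinearMap.id ℂ H))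
    (hee : e.comp e = -((r : ℂ) • ContinuousLinearMap.id ℂ H))
    (hcD : c.comp D = -(D.comp c))
    (hce : c.comp e = -(e.comp c))
    (heD : e.comp D = -(D.comp e))
    (u u' u'' : ℝ → H)
    (hu : ∀ s ∈ Ioi (0 : ℝ), HasDerivAt u (u' s) s)
    (hu' : ∀ s ∈ Ioi (0 : ℝ), HasDerivAt u' (u'' s) s) :
    ∃ Nd : ℝ → H,
      (∀ s ∈ Ioi (0 : ℝ),
        HasDerivAt (fun σ : ℝ => c (u' σ) + ((σ : ℂ))⁻¹ • D (u σ) + Complex.I • e (u σ))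
          (Nd s) s) ∧
      (∀ s ∈ Ioi (0 : ℝ),
        c (Nd s)
            + ((s : ℂ))⁻¹ • D (c (u' s) + ((s : ℂ))⁻¹ • D (u s) + Complex.I • e (u s))
            + Complex.I • e (c (u' s) + ((s : ℂ))⁻¹ • D (u s) + Complex.I • e (u s))
          = -u'' s + (((s : ℂ)) ^ 2)⁻¹ • (D (D (u s)) - c (D (u s))) + (r : ℂ) • u s) := by
  have hD (L : H →L[ℂ] H) {f : ℝ → H} {f' : H} {s : ℝ} (hf : HasDerivAt f f' s) :
      HasDerivAt (fun σ => L (f σ)) (L f') s :=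
    (L.restrictScalars ℝ).hasFDerivAt.comp_hasDerivAt s hf
  refine ⟨fun s => c (u'' s) + ((s : ℂ)⁻¹ • D (u' s) + (-((s : ℂ) ^ 2)⁻¹) • D (u s))
    + Complex.I • e (u' s), fun s hs => ?_, fun s hs => ?_⟩
  · have hs0 : (s : ℂ) ≠ 0 := Complex.ofReal_ne_zero.mpr (ne_of_gt hs)
    have hinv : HasDerivAt (fun σ : ℝ => (σ : ℂ)⁻¹) (-((s : ℂ) ^ 2)⁻¹) s :=
      (hasDerivAt_inv hs0).comp_ofReal
    exact ((hD c (hu' s hs)).add (hinv.smul (hD D (hu s hs)))).add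
      ((hD e (hu s hs)).const_smul Complex.I)
  · have hcc' (x : H) : c (c x) = -x := by simpa using DFunLike.congr_fun hcc x
    have hee' (x : H) : e (e x) = -((r : ℂ) • x) := by simpa using DFunLike.congr_fun hee x
    have hcD' (x : H) : c (D x) = -D (c x) := by simpa using DFunLike.congr_fun hcD x
    have hce' (x : H) : c (e x) = -e (c x) := by simpa using DFunLike.congr_fun hce x
    have heD' (x : H) : e (D x) = -D (e x) := by simpa using DFunLike.congr_fun heD x
    simp only [map_add, map_smul, hcc', hee', hcD', hce', heD']
    match_scalars <;> ring_nf <;> simp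
end

section
/- Let H be a complex normed vector space, let r ≥ 0 be a real number, let e : H → H be a continuous linear map with e ∘ e = −r·id, and let λ ∈ ℝ. For twice differentiable functions p, q : (0,∞) → H define Ñ(p,q) = ( i·e(p) + q′ + (λ/s)·q , −(p′ − (λ/s)·p) − i·e(q) ). Then Ñ(Ñ(p,q)) = ( r·p − p″ + (λ² − λ)s⁻²·p , r·q − q″ + (λ² + λ)s⁻²·q ), i.e. the square of the 2×2 system operator Ñ is diagonal with entries −∂_s² + (λ²−λ)/s² + r and −∂_s² + (λ²+λ)/s² + r. -/
open Set

/-- A complex-linear continuous map commutes with real differentiation of curves. -/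
theorem hasDerivAt_clm_comp {E F : Type*} [NormedAddCommGroup E] [NormedSpace ℂ E]
    [NormedAddCommGroup F] [NormedSpace ℂ F] (e : E →L[ℂ] F) {f : ℝ → E} {f' : E} {s : ℝ}
    (hf : HasDerivAt f f' s) : HasDerivAt (fun σ => e (f σ)) (e f') s :=
  (e.restrictScalars ℝ).hasFDerivAt.comp_hasDerivAt s hf

/-- Leibniz rule for a curve multiplied by the complex-valued function `c / s`. -/
theorem hasDerivAt_div_smul {E : Type*} [NormedAddCommGroup E] [NormedSpace ℂ E] (c : ℝ)
    {f : ℝ → E} {f' : E} {s : ℝ} (hs : s ≠ 0) (hf : HasDerivAt f f' s) :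
    HasDerivAt (fun σ : ℝ => ((c / σ : ℝ) : ℂ) • f σ)
      (((c / s : ℝ) : ℂ) • f' + ((-c / s ^ 2 : ℝ) : ℂ) • f s) s := by
  have hdiv : HasDerivAt (fun σ : ℝ => c / σ) (-c / s ^ 2) s := by
    simpa using (hasDerivAt_const s c).fun_div (hasDerivAt_id' s) hs
  exact hdiv.ofReal_comp.smul hf

/-- With `e² = -r·id` and `λ ∈ ℝ`, the square of the 2×2 system operator
`Ñ(p,q) = (i e p + q' + (λ/s) q, -(p' - (λ/s) p) - i e q)` is diagonal with entries
`-∂ₛ² + (λ²-λ)/s² + r` and `-∂ₛ² + (λ²+λ)/s² + r`. -/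
theorem stmt_3 {H : Type*} [NormedAddCommGroup H] [NormedSpace ℂ H]
    (r : ℝ) (hr : 0 ≤ r)
    (e : H →L[ℂ] H)
    (hee : e.comp e = -((r : ℂ) • ContinuousLinearMap.id ℂ H))
    (lam : ℝ)
    (p q p' q' p'' q'' : ℝ → H)
    (hp : ∀ s ∈ Ioi (0 : ℝ), HasDerivAt p (p' s) s)
    (hp' : ∀ s ∈ Ioi (0 : ℝ), HasDerivAt p' (p'' s) s)
    (hq : ∀ s ∈ Ioi (0 : ℝ), HasDerivAt q (q' s) s)
    (hq' : ∀ s ∈ Ioi (0 : ℝ), HasDerivAt q' (q'' s) s) :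
    ∃ A' B' : ℝ → H,
      (∀ s ∈ Ioi (0 : ℝ),
        HasDerivAt (fun σ : ℝ =>
          Complex.I • e (p σ) + q' σ + ((lam / σ : ℝ) : ℂ) • q σ) (A' s) s) ∧
      (∀ s ∈ Ioi (0 : ℝ),
        HasDerivAt (fun σ : ℝ =>
          -(p' σ - ((lam / σ : ℝ) : ℂ) • p σ) - Complex.I • e (q σ)) (B' s) s) ∧
      (∀ s ∈ Ioi (0 : ℝ),
        Complex.I • e (Complex.I • e (p s) + q' s + ((lam / s : ℝ) : ℂ) • q s)
            + B' s
            + ((lam / s : ℝ) : ℂ) •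
                (-(p' s - ((lam / s : ℝ) : ℂ) • p s) - Complex.I • e (q s))
          = (r : ℂ) • p s - p'' s + (((lam ^ 2 - lam) / s ^ 2 : ℝ) : ℂ) • p s) ∧
      (∀ s ∈ Ioi (0 : ℝ),
        -(A' s - ((lam / s : ℝ) : ℂ) •
              (Complex.I • e (p s) + q' s + ((lam / s : ℝ) : ℂ) • q s))
            - Complex.I • e (-(p' s - ((lam / s : ℝ) : ℂ) • p s) - Complex.I • e (q s))
          = (r : ℂ) • q s - q'' s + (((lam ^ 2 + lam) / s ^ 2 : ℝ) : ℂ) • q s) := by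
  have he_sq (x : H) : e (e x) = -((r : ℂ) • x) := by
    simpa using congrArg (fun f : H →L[ℂ] H => f x) hee
  refine ⟨fun s => Complex.I • e (p' s) + q'' s
      + (((lam / s : ℝ) : ℂ) • q' s + ((-lam / s ^ 2 : ℝ) : ℂ) • q s),
    fun s => -(p'' s - (((lam / s : ℝ) : ℂ) • p' s + ((-lam / s ^ 2 : ℝ) : ℂ) • p s))
      - Complex.I • e (q' s), fun s hs => ?_, fun s hs => ?_, fun s hs => ?_, fun s hs => ?_⟩
  · exact ((hasDerivAt_clm_comp e (hp s hs)).const_smul Complex.I |>.add (hq' s hs)).add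
      (hasDerivAt_div_smul lam (ne_of_gt hs) (hq s hs))
  · exact ((hp' s hs).sub (hasDerivAt_div_smul lam (ne_of_gt hs) (hp s hs))).neg.sub
      ((hasDerivAt_clm_comp e (hq s hs)).const_smul Complex.I)
  all_goals
    have hs0 : (s : ℂ) ≠ 0 := Complex.ofReal_ne_zero.mpr (ne_of_gt hs)
    simp only [map_add, map_sub, map_neg, map_smul, he_sq]
    push_cast
    match_scalars <;> field_simp <;> ring_nf <;> simp [Complex.I_sq]
end

section
/- Let H be a finite-dimensional complex inner product space and let A : H → H be a self-adjoint linear map. If u : (0,∞) → H is differentiable, satisfies u′(s) = s⁻¹·A(u(s)) for all s > 0, and ∫₀^∞ ‖u(s)‖² ds < ∞, then u(s) = 0 for all s > 0. -/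
open Set MeasureTheory

/-- A differentiable solution on `(0,∞)` of the scalar Euler equation `f'(s) = s⁻¹ c f(s)` is
the power function `s ↦ s ^ c • f 1`. -/
lemma eq_rpow_smul_of_hasDerivAt {E : Type*} [NormedAddCommGroup E] [NormedSpace ℝ E]
    {c : ℝ} {f : ℝ → E} (hf : ∀ s ∈ Ioi (0 : ℝ), HasDerivAt f ((s⁻¹ * c) • f s) s)
    {s : ℝ} (hs : 0 < s) : f s = s ^ c • f 1 := by
  have hd : ∀ t ∈ Ioi (0 : ℝ), HasDerivAt (fun t => t ^ (-c) • f t) 0 t := by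
    intro t ht
    have ht0 : t ≠ 0 := ne_of_gt ht
    refine ((Real.hasDerivAt_rpow_const (p := -c) (Or.inl ht0)).smul (hf t ht)).congr_deriv ?_
    rw [smul_smul, ← add_smul, Real.rpow_sub_one ht0]
    convert zero_smul ℝ (f t) using 2
    field_simp
    ring
  have hconst : s ^ (-c) • f s = (1 : ℝ) ^ (-c) • f 1 :=
    isOpen_Ioi.is_const_of_deriv_eq_zero isPreconnected_Ioi
      (fun t ht => (hd t ht).differentiableAt.differentiableWithinAt)
      (fun t ht => (hd t ht).deriv) (mem_Ioi.2 hs) (mem_Ioi.2 one_pos)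
  rw [Real.one_rpow, one_smul] at hconst
  rw [← hconst, smul_smul, ← Real.rpow_add hs, add_neg_cancel, Real.rpow_zero, one_smul]

/-- A square-integrable solution on `(0,∞)` of `f'(s) = s⁻¹ c f(s)` vanishes. -/
lemma eq_zero_of_hasDerivAt_of_integrableOn_sq {E : Type*} [NormedAddCommGroup E]
    [NormedSpace ℝ E] {c : ℝ} {f : ℝ → E}
    (hf : ∀ s ∈ Ioi (0 : ℝ), HasDerivAt f ((s⁻¹ * c) • f s) s)
    (hL2 : IntegrableOn (fun s => ‖f s‖ ^ 2) (Ioi 0)) {s : ℝ} (hs : 0 < s) : f s = 0 := by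
  suffices h : f 1 = 0 by rw [eq_rpow_smul_of_hasDerivAt hf hs, h, smul_zero]
  by_contra h
  have hn : ‖f 1‖ ≠ 0 := norm_ne_zero_iff.2 h
  refine not_integrableOn_Ioi_rpow (c * 2) ?_
  refine IntegrableOn.congr_fun (hL2.const_mul ((‖f 1‖ ^ 2)⁻¹)) (fun t ht => ?_)
    measurableSet_Ioi
  have ht0 : (0 : ℝ) < t := ht
  have hpow : t ^ (c * 2) = (t ^ c) ^ 2 := mod_cast Real.rpow_mul_natCast ht0.le c 2
  rw [eq_rpow_smul_of_hasDerivAt hf ht0, norm_smul, Real.norm_of_nonneg (by positivity), hpow]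
  field_simp

/-- If `A` is a self-adjoint endomorphism of a finite-dimensional complex inner product
space, any solution `u` on `(0,∞)` of `u'(s) = s⁻¹ A u(s)` with `∫₀^∞ ‖u‖² < ∞`
vanishes identically. -/
theorem stmt_4 {H : Type*} [NormedAddCommGroup H] [InnerProductSpace ℂ H]
    [FiniteDimensional ℂ H]
    (A : H →ₗ[ℂ] H) (hA : LinearMap.IsSymmetric A)
    (u : ℝ → H)
    (hu : ∀ s ∈ Ioi (0 : ℝ), HasDerivAt u (((s : ℂ))⁻¹ • A (u s)) s)
    (hL2 : IntegrableOn (fun s : ℝ => ‖u s‖ ^ 2) (Ioi 0)) :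
    ∀ s ∈ Ioi (0 : ℝ), u s = 0 := by
  intro s hs
  let b := hA.eigenvectorBasis rfl
  refine b.toBasis.ext_elem fun i => ?_
  simp only [OrthonormalBasis.coe_toBasis_repr_apply, OrthonormalBasis.repr_apply_apply,
    inner_zero_right]
  have hd : ∀ t ∈ Ioi (0 : ℝ), HasDerivAt (fun t => inner ℂ (b i) (u t))
      ((t⁻¹ * hA.eigenvalues rfl i) • inner ℂ (b i) (u t)) t := by
    intro t ht
    refine (((innerSL ℂ (b i)).restrictScalars ℝ).hasFDerivAt.comp_hasDerivAt t
      (hu t ht)).congr_deriv ?_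
    have hAb : inner ℂ (b i) (A (u t)) = (hA.eigenvalues rfl i : ℂ) * inner ℂ (b i) (u t) := by
      rw [← hA, hA.apply_eigenvectorBasis rfl i, inner_smul_left]
      simp [b]
    simp [hAb, mul_assoc]
  refine eq_zero_of_hasDerivAt_of_integrableOn_sq hd ?_ hs
  refine Integrable.mono' hL2 ?_ (Filter.Eventually.of_forall fun t => ?_)
  · exact ContinuousOn.aestronglyMeasurable (fun t ht =>
      ((hd t ht).continuousAt.norm.pow 2).continuousWithinAt) measurableSet_Ioi
  · rw [Real.norm_of_nonneg (by positivity)]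
    gcongr
    simpa using norm_inner_le_norm (𝕜 := ℂ) (b i) (u t)
end

section
/- Let H be a complex Hilbert space, W ⊆ H a dense linear subspace, and T : W → H a linear map that is symmetric, i.e. ⟨Tu, v⟩ = ⟨u, Tv⟩ for all u, v ∈ W. Suppose there exist bounded linear operators G, R : H → H such that the range of G, the range of the Hilbert-space adjoint G*, and the range of R* are all contained in W, and such that T(G u) = u − R u for every u ∈ H. Then the unbounded operator T with domain W is self-adjoint: the domain of the adjoint T* equals W, and T*u = Tu for all u ∈ W. -/
open scoped ComplexInnerProductSpace

/-- A densely defined symmetric operator `T` on a complex Hilbert space which admits bounded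
operators `G, R` with `T ∘ G = Id - R` and with the ranges of `G`, `G*`, `R*` contained in the
domain of `T`, is self-adjoint: the adjoint of the unbounded operator `(W, T)` equals `(W, T)`. -/
theorem stmt_6 {H : Type*} [NormedAddCommGroup H] [InnerProductSpace ℂ H] [CompleteSpace H]
    (W : Submodule ℂ H) (hW : Dense (W : Set H))
    (T : W →ₗ[ℂ] H)
    (hsymm : ∀ u v : W, ⟪T u, (v : H)⟫ = ⟪(u : H), T v⟫)
    (G R : H →L[ℂ] H)
    (hG : ∀ x : H, G x ∈ W)
    (hGadj : ∀ x : H, ContinuousLinearMap.adjoint G x ∈ W)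
    (hRadj : ∀ x : H, ContinuousLinearMap.adjoint R x ∈ W)
    (hTG : ∀ x : H, T ⟨G x, hG x⟩ = x - R x) :
    LinearPMap.adjoint (⟨W, T⟩ : H →ₗ.[ℂ] H) = (⟨W, T⟩ : H →ₗ.[ℂ] H) := by
  set A : H →ₗ.[ℂ] H := ⟨W, T⟩
  have hle : A ≤ A.adjoint :=
    LinearPMap.IsFormalAdjoint.le_adjoint hW fun u v => hsymm u v
  refine (LinearPMap.eq_of_le_of_domain_eq hle (le_antisymm hle.1 fun u hu => ?_)).symm
  have key : u = ContinuousLinearMap.adjoint G (A.adjoint ⟨u, hu⟩)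
      + ContinuousLinearMap.adjoint R u := by
    refine ext_inner_right ℂ fun x => ?_
    have h : ⟪A.adjoint ⟨u, hu⟩, G x⟫ = ⟪u, T ⟨G x, hG x⟩⟫ :=
      LinearPMap.adjoint_isFormalAdjoint hW ⟨u, hu⟩ ⟨G x, hG x⟩
    rw [inner_add_left, ContinuousLinearMap.adjoint_inner_left,
      ContinuousLinearMap.adjoint_inner_left, h, hTG, inner_sub_right, sub_add_cancel]
  rw [key]
  exact W.add_mem (hGadj _) (hRadj _)
end

section
/- Let H be a complex Hilbert space, W ⊆ H a dense linear subspace, and T : W → H a linear map that is symmetric (⟨Tu, v⟩ = ⟨u, Tv⟩ for all u, v ∈ W). Suppose there exist COMPACT linear operators G, R : H → H such that the ranges of G, of G*, and of R* are contained in W and T(Gu) = u − Ru for all u ∈ H. Then: (i) the kernel {u ∈ W : Tu = 0} is finite-dimensional; (ii) for every λ ∈ ℂ with Im λ ≠ 0, the map T − λ·id : W → H is a bijection and its inverse (T − λ)⁻¹ : H → H is a compact operator. -/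
open scoped ComplexInnerProductSpace

section SymmetricOperator

variable {H : Type*} [NormedAddCommGroup H] [InnerProductSpace ℂ H]

/-- For a symmetric operator `T`, the operator `T - λ` is bounded below by `|Im λ|`. -/
lemma abs_im_mul_norm_le_of_symmetric {W : Submodule ℂ H} {T : W →ₗ[ℂ] H}
    (hsymm : ∀ u v : W, ⟪T u, (v : H)⟫ = ⟪(u : H), T v⟫) (lam : ℂ) (u : W) :
    |lam.im| * ‖(u : H)‖ ≤ ‖T u - lam • (u : H)‖ := by
  have hreal : (⟪(u : H), T u⟫).im = 0 := by
    have h := congrArg Complex.im (inner_conj_symm (u : H) (T u))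
    rw [hsymm u u, Complex.conj_im] at h
    linarith
  have him : (⟪(u : H), T u - lam • (u : H)⟫).im = -(lam.im * ‖(u : H)‖ ^ 2) := by
    rw [inner_sub_right, inner_smul_right, inner_self_eq_norm_sq_to_K, Complex.sub_im, hreal]
    norm_cast
    simp [-Complex.ofReal_pow]
  have hle : |lam.im| * ‖(u : H)‖ ^ 2 ≤ ‖(u : H)‖ * ‖T u - lam • (u : H)‖ := by
    calc |lam.im| * ‖(u : H)‖ ^ 2 = |(⟪(u : H), T u - lam • (u : H)⟫).im| := by
          rw [him, abs_neg, abs_mul, abs_of_nonneg (sq_nonneg ‖(u : H)‖)]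
      _ ≤ ‖⟪(u : H), T u - lam • (u : H)⟫‖ := Complex.abs_im_le_norm _
      _ ≤ _ := norm_inner_le_norm _ _
  rcases (norm_nonneg (u : H)).eq_or_lt with h0 | hpos
  · rw [← h0, mul_zero]; exact norm_nonneg _
  · nlinarith

variable [CompleteSpace H]

/-- The fixed space of the adjoint of a compact operator is finite-dimensional. -/
lemma finiteDimensional_ker_one_sub_adjoint {R : H →L[ℂ] H} (hR : IsCompactOperator ⇑R) :
    FiniteDimensional ℂ (LinearMap.ker
      ((1 - ContinuousLinearMap.adjoint R : H →L[ℂ] H) : H →ₗ[ℂ] H)) := by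
  set K := LinearMap.ker ((1 - ContinuousLinearMap.adjoint R : H →L[ℂ] H) : H →ₗ[ℂ] H)
  have hclosed : IsClosed (K : Set H) :=
    ContinuousLinearMap.isClosed_ker (1 - ContinuousLinearMap.adjoint R)
  have : CompleteSpace K := hclosed.completeSpace_coe
  have hcomp : IsCompactOperator (K.orthogonalProjectionOnto ∘ (R ∘ K.subtypeL)) :=
    (hR.comp_clm K.subtypeL).clm_comp K.orthogonalProjectionOnto
  have hid : K.orthogonalProjectionOnto ∘ (R ∘ K.subtypeL) = id := by
    funext k
    refine ext_inner_right ℂ fun l => ?_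
    have hl : ContinuousLinearMap.adjoint R (l : H) = l :=
      (sub_eq_zero.mp (LinearMap.mem_ker.mp l.2)).symm
    have h := Submodule.inner_orthogonalProjectionOnto_eq_of_mem_right l (R k)
    simp only [Function.comp_apply, Submodule.subtypeL_apply, id_eq, h]
    rw [← ContinuousLinearMap.adjoint_inner_right, hl, Submodule.coe_inner]
  rw [hid] at hcomp
  exact .of_isCompactOperator_id hcomp

/-- If `T` has a right parametrix `G` with error `R`, then every `v` in the domain of the adjoint
of `T` is recovered from `v` and its image `w` through `R*` and `G*`. -/
lemma eq_adjoint_add_adjoint_of_parametrix {W : Submodule ℂ H} {T : W →ₗ[ℂ] H} {G R : H →L[ℂ] H}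
    (hG : ∀ x : H, G x ∈ W) (hTG : ∀ x : H, T ⟨G x, hG x⟩ = x - R x) {v w : H}
    (hvw : ∀ u : W, ⟪T u, v⟫ = ⟪(u : H), w⟫) :
    v = ContinuousLinearMap.adjoint R v + ContinuousLinearMap.adjoint G w := by
  refine ext_inner_left ℂ fun x => ?_
  have h := hvw ⟨G x, hG x⟩
  rw [hTG, inner_sub_left] at h
  rw [inner_add_right, ContinuousLinearMap.adjoint_inner_right,
    ContinuousLinearMap.adjoint_inner_right]
  linear_combination h

/-- A densely defined symmetric operator with a right parametrix whose adjoint, and the adjoint of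
whose error, map into the domain is self-adjoint. -/
lemma exists_mem_domain_of_parametrix {W : Submodule ℂ H} (hW : Dense (W : Set H))
    {T : W →ₗ[ℂ] H} (hsymm : ∀ u v : W, ⟪T u, (v : H)⟫ = ⟪(u : H), T v⟫) {G R : H →L[ℂ] H}
    (hG : ∀ x : H, G x ∈ W)
    (hGadj : ∀ x : H, ContinuousLinearMap.adjoint G x ∈ W)
    (hRadj : ∀ x : H, ContinuousLinearMap.adjoint R x ∈ W)
    (hTG : ∀ x : H, T ⟨G x, hG x⟩ = x - R x) {v w : H}
    (hvw : ∀ u : W, ⟪T u, v⟫ = ⟪(u : H), w⟫) : ∃ h : v ∈ W, T ⟨v, h⟩ = w := by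
  have hv : v ∈ W := by
    rw [eq_adjoint_add_adjoint_of_parametrix hG hTG hvw]
    exact W.add_mem (hRadj v) (hGadj w)
  refine ⟨hv, hW.eq_of_inner_right (𝕜 := ℂ) fun u hu => ?_⟩
  rw [← hsymm ⟨u, hu⟩ ⟨v, hv⟩]
  exact hvw ⟨u, hu⟩

/-- A self-adjoint operator `T` has `T - λ` surjective for every non-real `λ`. -/
lemma surjective_sub_smul_of_selfAdjoint {W : Submodule ℂ H} {T : W →ₗ[ℂ] H}
    (hsymm : ∀ u v : W, ⟪T u, (v : H)⟫ = ⟪(u : H), T v⟫)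
    (hself : ∀ v w : H, (∀ u : W, ⟪T u, v⟫ = ⟪(u : H), w⟫) → ∃ h : v ∈ W, T ⟨v, h⟩ = w)
    {lam : ℂ} (hlam : lam.im ≠ 0) :
    Function.Surjective (T - lam • W.subtype) := by
  have hpos : 0 < |lam.im| := abs_pos.mpr hlam
  set A : W →ₗ[ℂ] H := T - lam • W.subtype with hA
  have hApp : ∀ u : W, A u = T u - lam • (u : H) := fun u => by simp [hA]
  have hclosed : IsClosed (LinearMap.range A : Set H) := by
    refine IsSeqClosed.isClosed fun y y₀ hy hlim => ?_
    choose u hu using hy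
    have hcauchy : CauchySeq fun n => (u n : H) := by
      rw [Metric.cauchySeq_iff']
      intro ε hε
      obtain ⟨N, hN⟩ := Metric.cauchySeq_iff'.mp hlim.cauchySeq (|lam.im| * ε) (by positivity)
      refine ⟨N, fun n hn => ?_⟩
      have hb := abs_im_mul_norm_le_of_symmetric hsymm lam (u n - u N)
      rw [← hApp, map_sub, hu, hu, ← dist_eq_norm, Submodule.coe_sub, ← dist_eq_norm] at hb
      exact lt_of_mul_lt_mul_left (hb.trans_lt (hN n hn)) hpos.le
    obtain ⟨u₀, hu₀⟩ := cauchySeq_tendsto_of_complete hcauchy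
    have hT : Filter.Tendsto (fun n => T (u n)) Filter.atTop (nhds (y₀ + lam • u₀)) := by
      refine (hlim.add (hu₀.const_smul lam)).congr fun n => ?_
      rw [← hu, hApp, sub_add_cancel]
    obtain ⟨h, hTu⟩ := hself u₀ (y₀ + lam • u₀) fun v =>
      tendsto_nhds_unique
        ((tendsto_const_nhds (x := T v)).inner hu₀)
        (((tendsto_const_nhds (x := (v : H))).inner hT).congr fun n => (hsymm v (u n)).symm)
    exact ⟨⟨u₀, h⟩, by rw [hApp, hTu, add_sub_cancel_right]⟩
  have horth : (LinearMap.range A)ᗮ = ⊥ := by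
    rw [Submodule.eq_bot_iff]
    intro y hy
    obtain ⟨h, hTy⟩ := hself y (starRingEnd ℂ lam • y) fun u => by
      have h0 : ⟪A u, y⟫ = 0 := (Submodule.mem_orthogonal _ y).mp hy _ ⟨u, rfl⟩
      rw [hApp, inner_sub_left, inner_smul_left] at h0
      rw [inner_smul_right]
      exact sub_eq_zero.mp h0
    have hb := abs_im_mul_norm_le_of_symmetric hsymm (starRingEnd ℂ lam) ⟨y, h⟩
    rw [hTy, sub_self, norm_zero, Complex.conj_im, abs_neg] at hb
    exact norm_le_zero_iff.mp (nonpos_of_mul_nonpos_right hb hpos)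
  have : CompleteSpace (LinearMap.range A) := hclosed.completeSpace_coe
  exact LinearMap.range_eq_top.mp ((Submodule.orthogonal_eq_bot_iff).mp horth)

end SymmetricOperator

/-- A densely defined symmetric operator `T` on a complex Hilbert space admitting COMPACT
operators `G, R` with `T ∘ G = Id - R` and ranges of `G`, `G*`, `R*` in the domain of `T`
has finite-dimensional kernel, and for every non-real `λ` the map `T - λ` is a bijection
from the domain onto `H` with compact inverse. -/
theorem stmt_7 {H : Type*} [NormedAddCommGroup H] [InnerProductSpace ℂ H] [CompleteSpace H]
    (W : Submodule ℂ H) (hW : Dense (W : Set H))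
    (T : W →ₗ[ℂ] H)
    (hsymm : ∀ u v : W, ⟪T u, (v : H)⟫ = ⟪(u : H), T v⟫)
    (G R : H →L[ℂ] H)
    (hGcomp : IsCompactOperator ⇑G) (hRcomp : IsCompactOperator ⇑R)
    (hG : ∀ x : H, G x ∈ W)
    (hGadj : ∀ x : H, ContinuousLinearMap.adjoint G x ∈ W)
    (hRadj : ∀ x : H, ContinuousLinearMap.adjoint R x ∈ W)
    (hTG : ∀ x : H, T ⟨G x, hG x⟩ = x - R x) :
    FiniteDimensional ℂ (LinearMap.ker T) ∧
    ∀ lam : ℂ, lam.im ≠ 0 →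
      Function.Bijective (fun u : W => T u - lam • (u : H)) ∧
      ∃ S : H →L[ℂ] H, IsCompactOperator ⇑S ∧
        (∀ x : H, S x ∈ W) ∧
        (∀ u : W, S (T u - lam • (u : H)) = u) ∧
        (∀ x : H, ∃ h : S x ∈ W, T ⟨S x, h⟩ - lam • S x = x) := by
  refine ⟨?_, fun lam hlam => ?_⟩
  · have := finiteDimensional_ker_one_sub_adjoint hRcomp
    have hfix : ∀ u : LinearMap.ker T, W.subtype ((LinearMap.ker T).subtype u) ∈ LinearMap.ker
        ((1 - ContinuousLinearMap.adjoint R : H →L[ℂ] H) : H →ₗ[ℂ] H) := fun u => by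
      have h := eq_adjoint_add_adjoint_of_parametrix hG hTG fun v => hsymm v u
      rw [LinearMap.mem_ker.mp u.2, map_zero, add_zero] at h
      exact LinearMap.mem_ker.mpr (sub_eq_zero.mpr h)
    refine FiniteDimensional.of_injective
      ((W.subtype ∘ₗ (LinearMap.ker T).subtype).codRestrict _ hfix) fun u v huv => ?_
    have huv_coe := congrArg Subtype.val huv
    exact Subtype.ext (Subtype.ext huv_coe)
  · have hpos : 0 < |lam.im| := abs_pos.mpr hlam
    have hbound := abs_im_mul_norm_le_of_symmetric hsymm lam
    have hbij : Function.Bijective (T - lam • W.subtype) := by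
      refine ⟨(injective_iff_map_eq_zero _).mpr fun u hu => ?_,
        surjective_sub_smul_of_selfAdjoint hsymm (fun v w hvw =>
          exists_mem_domain_of_parametrix hW hsymm hG hGadj hRadj hTG hvw) hlam⟩
      have hb := hbound u
      rw [show T u - lam • (u : H) = 0 from hu, norm_zero] at hb
      exact Subtype.ext (norm_le_zero_iff.mp (nonpos_of_mul_nonpos_right hb hpos))
    refine ⟨hbij, ?_⟩
    let e : W ≃ₗ[ℂ] H := LinearEquiv.ofBijective _ hbij
    have he : ∀ x, T (e.symm x) - lam • (e.symm x : H) = x := e.apply_symm_apply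
    let S : H →L[ℂ] H := (W.subtype ∘ₗ e.symm.toLinearMap).mkContinuous |lam.im|⁻¹ fun x => by
      have hb := hbound (e.symm x)
      rw [he] at hb
      exact (le_inv_mul_iff₀ hpos).mpr hb
    have hleft : ∀ u : W, S (T u - lam • (u : H)) = u := fun u =>
      congrArg Subtype.val (e.symm_apply_apply u)
    have hresolvent : G + S.comp (R + lam • G) = S := by
      ext x
      have h := hleft ⟨G x, hG x⟩
      rw [hTG, sub_sub, map_sub] at h
      exact sub_eq_iff_eq_add.mp h |>.symm
    refine ⟨S, ?_, fun x => (e.symm x).2, hleft, fun x => ⟨(e.symm x).2, he x⟩⟩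
    rw [← hresolvent]
    exact hGcomp.add ((hRcomp.add (hGcomp.smul lam)).clm_comp S)
end

section
/- Let h : (0,∞) → ℝ be continuous with h(s) > 0 for all s > 0, h(s) = s for 0 < s ≤ 1, and h(s) = 1 for s ≥ 2, and let μ ∈ ℝ. Suppose a, b : (0,∞) → ℂ are differentiable, satisfy i·h(s)·a′(s) + μ·b(s) = 0 and μ·a(s) − i·h(s)·b′(s) = 0 for all s > 0, and satisfy both ∫₀^∞ (|a(s)|² + |b(s)|²) ds < ∞ and ∫₀¹ s⁻¹·(|a(s)|² + |b(s)|²) ds < ∞. Then a(s) = 0 and b(s) = 0 for all s > 0. -/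
open Set MeasureTheory

/-- A function that is monotone on `(0, ∞)` and dominated there by an integrable function is
nonpositive. -/
lemma MonotoneOn.nonpos_of_le_integrableOn_Ioi {f G : ℝ → ℝ} (hf : MonotoneOn f (Ioi 0))
    (hfG : ∀ s ∈ Ioi (0 : ℝ), f s ≤ G s) (hG : IntegrableOn G (Ioi 0)) :
    ∀ s ∈ Ioi (0 : ℝ), f s ≤ 0 := by
  intro s hs
  by_contra! hfs
  have hs' : Ioi s ⊆ Ioi 0 := Ioi_subset_Ioi (le_of_lt hs)
  have hconst : IntegrableOn (fun _ : ℝ => f s) (Ioi s) := by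
    refine Integrable.mono' (hG.mono_set hs') aestronglyMeasurable_const ?_
    filter_upwards [ae_restrict_mem measurableSet_Ioi] with t ht
    rw [Real.norm_of_nonneg hfs.le]
    exact (hf hs (hs' ht) (le_of_lt ht)).trans (hfG t (hs' ht))
  rw [integrableOn_const_iff] at hconst
  simp [hfs.ne'] at hconst

/-- A function `f` that is antitone on `(0, ∞)` and dominated there by a function `G` such that
`s⁻¹ * G s` is integrable near `0` is nonpositive. -/
lemma AntitoneOn.nonpos_of_le_integrableOn_inv_mul {f G : ℝ → ℝ} (hf : AntitoneOn f (Ioi 0))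
    (hfG : ∀ s ∈ Ioi (0 : ℝ), f s ≤ G s)
    (hG : IntegrableOn (fun s : ℝ => s⁻¹ * G s) (Ioc 0 1)) :
    ∀ s ∈ Ioi (0 : ℝ), f s ≤ 0 := by
  intro s hs
  by_contra! hfs
  have hmin : 0 < min s 1 := lt_min hs one_pos
  have hinv : IntegrableOn (fun t : ℝ => t⁻¹ * f s) (Ioc 0 (min s 1)) := by
    refine Integrable.mono' (hG.mono_set (Ioc_subset_Ioc_right (min_le_right s 1)))
      (by fun_prop) ?_
    filter_upwards [ae_restrict_mem measurableSet_Ioc] with t ht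
    have ht0 : 0 < t := ht.1
    rw [Real.norm_of_nonneg (by positivity)]
    gcongr
    exact (hf ht0 hs (ht.2.trans (min_le_left s 1))).trans (hfG t ht0)
  have hinv' : IntervalIntegrable (fun t : ℝ => t⁻¹) volume 0 (min s 1) := by
    rw [intervalIntegrable_iff_integrableOn_Ioc_of_le hmin.le]
    refine (hinv.mul_const (f s)⁻¹).congr (.of_forall fun t => ?_)
    simp [hfs.ne']
  simp [intervalIntegrable_inv_iff, hmin.ne, hmin.le] at hinv'

/-- A solution of `h w' = ν w` on `(0, ∞)` with `h > 0` vanishes if `‖w‖ ^ 2` is dominated by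
a function that is integrable on `(0, ∞)` and integrable with weight `s⁻¹` near `0`. -/
lemma eq_zero_of_hasDerivAt_of_norm_sq_le {h : ℝ → ℝ} (hpos : ∀ s ∈ Ioi (0 : ℝ), 0 < h s)
    {ν : ℝ} {w w' : ℝ → ℂ} (hw : ∀ s ∈ Ioi (0 : ℝ), HasDerivAt w (w' s) s)
    (hode : ∀ s ∈ Ioi (0 : ℝ), (h s : ℂ) * w' s = ν * w s) {G : ℝ → ℝ}
    (hwG : ∀ s ∈ Ioi (0 : ℝ), ‖w s‖ ^ 2 ≤ G s) (hG : IntegrableOn G (Ioi 0))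
    (hGw : IntegrableOn (fun s : ℝ => s⁻¹ * G s) (Ioc 0 1)) :
    ∀ s ∈ Ioi (0 : ℝ), w s = 0 := by
  have hderiv : ∀ s ∈ Ioi (0 : ℝ),
      HasDerivAt (fun t => ‖w t‖ ^ 2) (2 * (ν / h s * ‖w s‖ ^ 2)) s := by
    intro s hs
    have hne : (h s : ℂ) ≠ 0 := by exact_mod_cast (hpos s hs).ne'
    have hw' : w' s = (ν / h s : ℝ) • w s := by
      rw [Complex.real_smul]
      push_cast
      field_simp
      linear_combination hode s hs
    have hd := (hw s hs).norm_sq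
    rwa [hw', real_inner_smul_right, real_inner_self_eq_norm_sq] at hd
  have hcont : ContinuousOn (fun t => ‖w t‖ ^ 2) (Ioi 0) :=
    fun s hs => (hderiv s hs).continuousAt.continuousWithinAt
  have hnonpos : ∀ s ∈ Ioi (0 : ℝ), ‖w s‖ ^ 2 ≤ 0 := by
    rcases le_total 0 ν with hν | hν
    · refine MonotoneOn.nonpos_of_le_integrableOn_Ioi ?_ hwG hG
      refine monotoneOn_of_hasDerivWithinAt_nonneg (convex_Ioi 0) hcont
        (fun s hs => (hderiv s (interior_subset hs)).hasDerivWithinAt) fun s hs => ?_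
      have := hpos s (interior_subset hs)
      positivity
    · refine AntitoneOn.nonpos_of_le_integrableOn_inv_mul ?_ hwG hGw
      refine antitoneOn_of_hasDerivWithinAt_nonpos (convex_Ioi 0) hcont
        (fun s hs => (hderiv s (interior_subset hs)).hasDerivWithinAt) fun s hs => ?_
      have hle := div_nonpos_of_nonpos_of_nonneg hν (hpos s (interior_subset hs)).le
      have := mul_nonpos_of_nonpos_of_nonneg hle (sq_nonneg ‖w s‖)
      linarith
  intro s hs
  simpa using le_antisymm (hnonpos s hs) (sq_nonneg _)

/-- For the b-c suspension warping factor `h` (`h(s) = s` for `s ≤ 1`, `h ≡ 1` for `s ≥ 2`,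
positive and continuous on `(0,∞)`), any differentiable solution `(a, b)` on `(0,∞)` of the
system `i h a' + μ b = 0`, `μ a - i h b' = 0` which is square-integrable on `(0,∞)` and
satisfies the weighted condition `∫₀¹ s⁻¹ (|a|² + |b|²) ds < ∞` vanishes identically. -/
theorem stmt_13 (h : ℝ → ℝ) (hcont : ContinuousOn h (Ioi 0))
    (hpos : ∀ s ∈ Ioi (0 : ℝ), 0 < h s)
    (h1 : ∀ s : ℝ, 0 < s → s ≤ 1 → h s = s)
    (h2 : ∀ s : ℝ, 2 ≤ s → h s = 1)
    (μ : ℝ) (a b a' b' : ℝ → ℂ)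
    (ha : ∀ s ∈ Ioi (0 : ℝ), HasDerivAt a (a' s) s)
    (hb : ∀ s ∈ Ioi (0 : ℝ), HasDerivAt b (b' s) s)
    (hsys : ∀ s ∈ Ioi (0 : ℝ),
      Complex.I * (h s : ℂ) * a' s + (μ : ℂ) * b s = 0 ∧
      (μ : ℂ) * a s - Complex.I * (h s : ℂ) * b' s = 0)
    (hL2 : IntegrableOn (fun s : ℝ => ‖a s‖ ^ 2 + ‖b s‖ ^ 2) (Ioi 0))
    (hL2w : IntegrableOn (fun s : ℝ => s⁻¹ * (‖a s‖ ^ 2 + ‖b s‖ ^ 2)) (Ioc 0 1)) :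
    ∀ s ∈ Ioi (0 : ℝ), a s = 0 ∧ b s = 0 := by
  have hbound : ∀ x y : ℂ, ‖y‖ = 1 → ∀ z : ℂ, ‖x + y * z‖ ^ 2 ≤ 2 * (‖x‖ ^ 2 + ‖z‖ ^ 2) := by
    intro x y hy z
    have hle : ‖x + y * z‖ ≤ ‖x‖ + ‖z‖ := (norm_add_le _ _).trans_eq (by simp [hy])
    nlinarith [norm_nonneg (x + y * z), sq_nonneg (‖x‖ - ‖z‖)]
  have hG := hL2.const_mul 2
  have hGw : IntegrableOn (fun s : ℝ => s⁻¹ * (2 * (‖a s‖ ^ 2 + ‖b s‖ ^ 2))) (Ioc 0 1) :=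
    (hL2w.const_mul 2).congr (.of_forall fun s => by ring)
  have hplus := eq_zero_of_hasDerivAt_of_norm_sq_le hpos (ν := μ)
    (w := fun s => a s + Complex.I * b s)
    (fun s hs => (ha s hs).add ((hb s hs).const_mul Complex.I))
    (fun s hs => by
      linear_combination -Complex.I * (hsys s hs).1 - (hsys s hs).2
        + ((h s : ℂ) * a' s) * Complex.I_sq)
    (fun s _ => hbound (a s) Complex.I Complex.norm_I (b s)) hG hGw
  have hminus := eq_zero_of_hasDerivAt_of_norm_sq_le hpos (ν := -μ)
    (w := fun s => a s + -Complex.I * b s)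
    (fun s hs => (ha s hs).add ((hb s hs).const_mul (-Complex.I)))
    (fun s hs => by
      push_cast
      linear_combination -Complex.I * (hsys s hs).1 + (hsys s hs).2
        + ((h s : ℂ) * a' s) * Complex.I_sq)
    (fun s _ => hbound (a s) (-Complex.I) (by simp) (b s)) hG hGw
  intro s hs
  have hp := hplus s hs
  have hm := hminus s hs
  constructor
  · linear_combination (hp + hm) / 2
  · linear_combination -Complex.I / 2 * (hp - hm) + b s * Complex.I_sq
end
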